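/- Let φ ∈ Φ(d) satisfy ∫ e^{φ(x)} dx = 1, and for t ∈ ℝ let D_t := {x ∈ ℝ^d : φ(x) ≥ t}. Then for all real r < M with M ≤ max_{x ∈ ℝ^d} φ(x), the Lebesgue measure of D_r satisfies Leb(D_r) ≤ (M − r)^d e^{−M} / ∫_0^{M − r} t^d e^{−t} dt. -/

import Mathlib

open MeasureTheory Filter Topology Set
open scoped ENNReal RealInnerProductSpace BoundedContinuousFunction

noncomputable section

/-- Truncation of an extended real number to `ℝ≥0∞`. -/
def EReal.toENN (x : EReal) : ℝ≥0∞ := if x = ⊤ then ⊤ else ENNReal.ofReal x.toReal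

/-- The real-valued exponential of an extended real number (`⊤` is sent to `0`,
but this value is never used for functions in the class `Φ`). -/
def EReal.expR (x : EReal) : ℝ := (EReal.exp x).toReal

/-- The class `Φ(d)`: upper semicontinuous, concave functions `φ : E → [-∞, ∞)`
which are coercive in the sense that `φ x → -∞` as `‖x‖ → ∞`. -/
def IsPhi {E : Type*} [NormedAddCommGroup E] [NormedSpace ℝ E] (φ : E → EReal) : Prop :=
  UpperSemicontinuous φ ∧ (∀ x, φ x ≠ ⊤) ∧
  (∀ x y : E, ∀ a b : ℝ, 0 < a → 0 < b → a + b = 1 →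
    (a : EReal) * φ x + (b : EReal) * φ y ≤ φ (a • x + b • y)) ∧
  Tendsto φ (Filter.comap (fun x : E => ‖x‖) atTop) (𝓝 ⊥)

/-- The integral of an `EReal`-valued function with respect to a measure,
defined as the difference of the integrals of the positive and negative parts. -/
def eint {E : Type*} [MeasurableSpace E] (Q : Measure E) (φ : E → EReal) : EReal :=
  ((∫⁻ x, (φ x).toENN ∂Q : ℝ≥0∞) : EReal) - ((∫⁻ x, (-(φ x)).toENN ∂Q : ℝ≥0∞) : EReal)

/-- The log-likelihood-type functional `L(φ, Q) = ∫ φ dQ - ∫ e^{φ(x)} dx + 1`. -/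
def Lfun {E : Type*} [NormedAddCommGroup E] [NormedSpace ℝ E] [MeasureSpace E]
    (φ : E → EReal) (Q : Measure E) : EReal :=
  eint Q φ - ((∫⁻ x, EReal.exp (φ x) : ℝ≥0∞) : EReal) + 1

/-- The profile log-likelihood `L(Q) = sup_{φ ∈ Φ} L(φ, Q)`. -/
def Lprof {E : Type*} [NormedAddCommGroup E] [NormedSpace ℝ E] [MeasureSpace E]
    (Q : Measure E) : EReal :=
  ⨆ φ ∈ {φ : E → EReal | IsPhi φ}, Lfun φ Q

/-- The convex support of a measure: the intersection of all closed convex sets of full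
measure. -/
def csupp {E : Type*} [NormedAddCommGroup E] [NormedSpace ℝ E] [MeasurableSpace E]
    (Q : Measure E) : Set E :=
  ⋂₀ {C : Set E | IsClosed C ∧ Convex ℝ C ∧ Q C = 1}

/-- `ψ` is the (a) maximizer of `L(·, Q)` over `Φ`, i.e. `ψ = ψ(·|Q)`. -/
def IsMLE {E : Type*} [NormedAddCommGroup E] [NormedSpace ℝ E] [MeasureSpace E]
    (Q : Measure E) (ψ : E → EReal) : Prop :=
  IsPhi ψ ∧ ∀ φ : E → EReal, IsPhi φ → Lfun φ Q ≤ Lfun ψ Q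

/-- Weak convergence of a sequence of measures. -/
def WConv {E : Type*} [NormedAddCommGroup E] [MeasurableSpace E]
    (Qn : ℕ → Measure E) (Q : Measure E) : Prop :=
  ∀ g : E →ᵇ ℝ, Tendsto (fun n => ∫ x, g x ∂(Qn n)) atTop (𝓝 (∫ x, g x ∂Q))

/-- The Mallows (Wasserstein-1, Kantorovich–Rubinstein) distance. -/
def D1 {E : Type*} [NormedAddCommGroup E] [MeasurableSpace E] (Q Q' : Measure E) : ℝ :=
  sSup {r : ℝ | ∃ h : E → ℝ, LipschitzWith 1 h ∧ r = |(∫ x, h x ∂Q) - ∫ x, h x ∂Q'|}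

/-- The bounded Lipschitz distance. -/
def DBL (Q Q' : Measure ℝ) : ℝ :=
  sSup {r : ℝ | ∃ h : ℝ → ℝ, (∀ x, |h x| ≤ 1) ∧ LipschitzWith 1 h ∧
    r = |(∫ x, h x ∂Q) - ∫ x, h x ∂Q'|}

/-- The Kolmogorov–Smirnov distance. -/
def DKS (Q Q' : Measure ℝ) : ℝ :=
  ⨆ t : ℝ, |(Q' (Set.Iic t)).toReal - (Q (Set.Iic t)).toReal|

/-- Convolution of two measures. -/
def mconv {E : Type*} [NormedAddCommGroup E] [MeasurableSpace E] (Q R : Measure E) : Measure E :=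
  (Q.prod R).map (fun p => p.1 + p.2)

/-- The empirical measure of a finite tuple of real numbers. -/
def empQ {n : ℕ} (v : Fin n → ℝ) : Measure ℝ :=
  ((n : ℝ≥0∞))⁻¹ • ∑ i, Measure.dirac (v i)

end

/-- **Lemma 4 (level sets).** Let `φ ∈ Φ(d)` with `∫ e^{φ} dx = 1` and let
`D_r = {x : φ(x) ≥ r}`. Then for `r < M ≤ max φ`,
`Leb(D_r) ≤ (M - r)^d e^{-M} / ∫₀^{M-r} t^d e^{-t} dt`. -/
theorem level_set_volume_bound {d : ℕ}
    (φ : EuclideanSpace ℝ (Fin d) → EReal) (hφ : IsPhi φ)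
    (hnorm : (∫⁻ x, EReal.exp (φ x)) = 1)
    (r M : ℝ) (hrM : r < M) (hM : ∃ x, (M : EReal) ≤ φ x) :
    volume {x : EuclideanSpace ℝ (Fin d) | (r : EReal) ≤ φ x} ≤
      ENNReal.ofReal ((M - r) ^ d * Real.exp (-M) /
        ∫ t in (0 : ℝ)..(M - r), t ^ d * Real.exp (-t)) := by
  obtain ⟨husc, htop, hconc, -⟩ := hφ
  obtain ⟨x0, hx0⟩ := hM
  have hmeas : Measurable φ := husc.measurable
  have hMr : 0 < M - r := sub_pos.2 hrM
  set V := volume {x : EuclideanSpace ℝ (Fin d) | (r : EReal) ≤ φ x} with hV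
  -- level sets
  have hlev : ∀ s ∈ Ioo r M, ENNReal.ofReal (((M - s) / (M - r)) ^ d) * V ≤
      volume {x : EuclideanSpace ℝ (Fin d) | (s : EReal) ≤ φ x} := by
    intro s hs
    have hc : 0 < (M - s) / (M - r) := div_pos (sub_pos.2 hs.2) hMr
    have hc1 : 0 < 1 - (M - s) / (M - r) := by
      rw [sub_pos, div_lt_one hMr]; linarith [hs.1]
    have key := Measure.addHaar_image_homothety
      (volume : Measure (EuclideanSpace ℝ (Fin d))) x0 ((M - s) / (M - r))
      {x | (r : EReal) ≤ φ x}
    rw [finrank_euclideanSpace_fin, abs_of_pos (pow_pos hc d)] at key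
    rw [hV, ← key]
    apply measure_mono
    rintro _ ⟨x, hx, rfl⟩
    simp only [mem_ofPred_eq] at hx ⊢
    have h := hconc x x0 _ _ hc hc1 (by ring)
    have e : AffineMap.homothety x0 ((M - s) / (M - r)) x =
        ((M - s) / (M - r)) • x + (1 - (M - s) / (M - r)) • x0 := by
      rw [AffineMap.homothety_apply, vsub_eq_sub, vadd_eq_add]
      module
    rw [e]
    refine le_trans ?_ h
    have h1 : (((M - s) / (M - r) : ℝ) : EReal) * (r : EReal) ≤
        (((M - s) / (M - r) : ℝ) : EReal) * φ x :=
      mul_le_mul_of_nonneg_left hx (by exact_mod_cast hc.le)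
    have h2 : ((1 - (M - s) / (M - r) : ℝ) : EReal) * (M : EReal) ≤
        ((1 - (M - s) / (M - r) : ℝ) : EReal) * φ x0 :=
      mul_le_mul_of_nonneg_left hx0 (by exact_mod_cast hc1.le)
    refine le_trans (le_of_eq ?_) (add_le_add h1 h2)
    rw [← EReal.coe_mul, ← EReal.coe_mul, ← EReal.coe_add]
    congr 1
    field_simp
    ring
  -- pointwise bound
  have hpt : ∀ x, ∫⁻ s in Ioo r M, (if (s : EReal) ≤ φ x then ENNReal.ofReal (Real.exp s) else 0)
      ≤ EReal.exp (φ x) := by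
    intro x
    induction h : φ x with
    | top => exact absurd h (htop x)
    | bot => simp
    | coe y =>
      rw [EReal.exp_coe]
      calc _ ≤ ∫⁻ s, (Iic y).indicator (fun s => ENNReal.ofReal (Real.exp s)) s := by
            refine (setLIntegral_le_lintegral _ _).trans (lintegral_mono fun s => ?_)
            simp [indicator_apply]
        _ = ∫⁻ s in Iic y, ENNReal.ofReal (Real.exp s) := lintegral_indicator measurableSet_Iic _
        _ = ENNReal.ofReal (∫ s in Iic y, Real.exp s) :=
            (ofReal_integral_eq_lintegral_ofReal (integrableOn_exp_Iic y)
              (ae_of_all _ fun s => (Real.exp_pos s).le)).symm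
        _ ≤ _ := by rw [integral_exp_Iic]
  set I := ∫ t in (0 : ℝ)..(M - r), t ^ d * Real.exp (-t) with hI
  have hIpos : 0 < I := by
    apply intervalIntegral.intervalIntegral_pos_of_pos_on
    · exact (by fun_prop : Continuous fun t : ℝ => t ^ d * Real.exp (-t)).intervalIntegrable _ _
    · intro t ht; exact mul_pos (pow_pos ht.1 d) (Real.exp_pos _)
    · exact hMr
  have hint : ∫ s in r..M, Real.exp s * ((M - s) / (M - r)) ^ d =
      Real.exp M / (M - r) ^ d * I := by
    have := intervalIntegral.integral_comp_sub_left
      (fun t => t ^ d * Real.exp (-t)) M (a := r) (b := M)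
    rw [sub_self] at this
    rw [hI, ← this, ← intervalIntegral.integral_const_mul]
    congr 1
    ext s
    rw [show -(M - s) = s - M by ring, Real.exp_sub, div_pow]
    field_simp
  have hmain : ENNReal.ofReal (Real.exp M / (M - r) ^ d * I) * V ≤ 1 := by
    rw [← hint, intervalIntegral.integral_of_le hrM.le, integral_Ioc_eq_integral_Ioo,
      ofReal_integral_eq_lintegral_ofReal, ← lintegral_mul_const, ← hnorm]
    · calc _ ≤ ∫⁻ s in Ioo r M, ∫⁻ x,
            (if (s : EReal) ≤ φ x then ENNReal.ofReal (Real.exp s) else 0) := by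
            refine setLIntegral_mono' measurableSet_Ioo fun s hs => ?_
            have hms : MeasurableSet {x | (s : EReal) ≤ φ x} :=
              measurableSet_le measurable_const hmeas
            have : ∫⁻ x, (if (s : EReal) ≤ φ x then ENNReal.ofReal (Real.exp s) else 0) =
                ENNReal.ofReal (Real.exp s) * volume {x | (s : EReal) ≤ φ x} := by
              rw [← lintegral_indicator_const hms]
              simp [indicator_apply]
            rw [this, ENNReal.ofReal_mul (Real.exp_pos s).le, mul_assoc]
            exact mul_le_mul_right (hlev s hs) _
        _ = ∫⁻ x, ∫⁻ s in Ioo r M,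
            (if (s : EReal) ≤ φ x then ENNReal.ofReal (Real.exp s) else 0) := by
            apply lintegral_lintegral_swap
            apply Measurable.aemeasurable
            refine Measurable.ite ?_ (by fun_prop) measurable_const
            exact measurableSet_le (measurable_coe_real_ereal.comp measurable_fst)
              (hmeas.comp measurable_snd)
        _ ≤ _ := lintegral_mono hpt
    · fun_prop
    · exact ((by fun_prop : Continuous fun s : ℝ => Real.exp s * ((M - s) / (M - r)) ^ d
        ).integrableOn_Icc).mono_set Ioo_subset_Icc_self
    · refine (ae_restrict_iff' measurableSet_Ioo).2 (ae_of_all _ fun s hs => ?_)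
      exact mul_nonneg (Real.exp_pos s).le
        (pow_nonneg (div_nonneg (sub_nonneg.2 hs.2.le) hMr.le) d)
  have hA : 0 < Real.exp M / (M - r) ^ d * I :=
    mul_pos (div_pos (Real.exp_pos M) (pow_pos hMr d)) hIpos
  have heq : (M - r) ^ d * Real.exp (-M) / I = (Real.exp M / (M - r) ^ d * I)⁻¹ := by
    rw [Real.exp_neg]
    field_simp
  rw [heq, ENNReal.ofReal_inv_of_pos hA, ENNReal.le_inv_iff_mul_le, mul_comm]
  exact hmain
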